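/- Every quadratic harmonic morphism φ = (φ¹,…,φ^{n+1}): ℝ^{2km(n)} → ℝ^{n+1} arises from a single quadratic function: there exist constants λ₁,…,λₖ ≥ 0, not all zero, and orthogonal transformations G₁,…,G_{n+1} ∈ O(2km(n)) such that φ^α = F∘G_α for all α = 1,…,n+1, where F: ℝ^{2km(n)} → ℝ is F(X₁,…,Xₖ) = Σ_{j=1}^k λⱼ·F₀(Xⱼ) for Xⱼ ∈ ℝ^{2m(n)}, and F₀: ℝ^{2m} → ℝ (with m = m(n)) is F₀(x₁,…,x_{2m}) = x₁²+…+x_m² − x_{m+1}²−…−x_{2m}². -/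

import Mathlib

open Matrix BigOperators

/-- Partial derivative in the `i`-th coordinate direction. -/
noncomputable def pderiv {m : ℕ} (i : Fin m) (f : (Fin m → ℝ) → ℝ) : (Fin m → ℝ) → ℝ :=
  fun x => fderiv ℝ f x (Pi.single i 1)

/-- A map `ℝ^m → ℝ^n` is a harmonic morphism iff each component is harmonic and
the map is horizontally weakly conformal. -/
def IsHarmonicMorphism {m n : ℕ} (φ : (Fin m → ℝ) → (Fin n → ℝ)) : Prop :=
  (∀ (α : Fin n) (x : Fin m → ℝ), ∑ i : Fin m, pderiv i (pderiv i fun y => φ y α) x = 0) ∧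
  ∃ lam : (Fin m → ℝ) → ℝ, ∀ (x : Fin m → ℝ) (α β : Fin n),
      ∑ i : Fin m, pderiv i (fun y => φ y α) x * pderiv i (fun y => φ y β) x
        = lam x ^ 2 * (if α = β then 1 else 0)

/-- `A` is the family of symmetric component matrices of the quadratic map `φ`;
the components are genuine (nonzero) quadratic forms. -/
def Represents {m n : ℕ} (A : Fin n → Matrix (Fin m) (Fin m) ℝ)
    (φ : (Fin m → ℝ) → (Fin n → ℝ)) : Prop :=
  (∀ α, (A α).IsSymm) ∧ (∀ α, A α ≠ 0) ∧ ∀ x α, φ x α = x ⬝ᵥ (A α).mulVec x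

/-- A quadratic harmonic morphism. -/
def IsQuadraticHM {m n : ℕ} (φ : (Fin m → ℝ) → (Fin n → ℝ)) : Prop :=
  (∃ A, Represents A φ) ∧ IsHarmonicMorphism φ

/-- `μ` is an eigenvalue of `A`. -/
def HasEigen {m : ℕ} (A : Matrix (Fin m) (Fin m) ℝ) (μ : ℝ) : Prop :=
  ∃ v : Fin m → ℝ, v ≠ 0 ∧ A.mulVec v = μ • v

/-- `φ` is Q-nonsingular: the common rank of the component matrices equals the
domain dimension. -/
def QNonsingular {m n : ℕ} (φ : (Fin m → ℝ) → (Fin n → ℝ)) : Prop :=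
  ∃ A, Represents A φ ∧ ∀ α, (A α).rank = m

/-- `φ` is umbilical: all positive eigenvalues of the component matrices are equal. -/
def Umbilical {m n : ℕ} (φ : (Fin m → ℝ) → (Fin n → ℝ)) : Prop :=
  ∃ A, Represents A φ ∧ ∀ (α : Fin n) (μ ν : ℝ), 0 < μ → 0 < ν →
    HasEigen (A α) μ → HasEigen (A α) ν → μ = ν

/-- `φ ∈ H₂¹(m,n)`: umbilical quadratic harmonic morphism with positive eigenvalue 1. -/
def MemH21 {m n : ℕ} (φ : (Fin m → ℝ) → (Fin n → ℝ)) : Prop :=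
  IsQuadraticHM φ ∧ ∃ A, Represents A φ ∧
    ∀ α : Fin n, HasEigen (A α) 1 ∧ ∀ μ : ℝ, 0 < μ → HasEigen (A α) μ → μ = 1

/-- `G` is an orthogonal matrix. -/
def IsOrthoMat {m : ℕ} (G : Matrix (Fin m) (Fin m) ℝ) : Prop := Gᵀ * G = 1

/-- Domain-equivalence: `φ = ψ ∘ G` for an orthogonal `G`. -/
def DomainEquiv {m n : ℕ} (φ ψ : (Fin m → ℝ) → (Fin n → ℝ)) : Prop :=
  ∃ G : Matrix (Fin m) (Fin m) ℝ, IsOrthoMat G ∧ ∀ x, φ x = ψ (G.mulVec x)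

/-- Bi-equivalence: `φ = H⁻¹ ∘ ψ ∘ G` for orthogonal `G`, `H`. -/
def BiEquiv {m n : ℕ} (φ ψ : (Fin m → ℝ) → (Fin n → ℝ)) : Prop :=
  ∃ (G : Matrix (Fin m) (Fin m) ℝ) (H : Matrix (Fin n) (Fin n) ℝ),
    IsOrthoMat G ∧ IsOrthoMat H ∧ ∀ x, φ x = H⁻¹.mulVec (ψ (G.mulVec x))

/-- A Clifford system: symmetric endomorphisms with `PᵢPⱼ + PⱼPᵢ = 2δᵢⱼ Id`. -/
def IsCliffordSystem {N n : ℕ} (P : Fin n → Matrix (Fin N) (Fin N) ℝ) : Prop :=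
  (∀ i, (P i).IsSymm) ∧
  ∀ i j, P i * P j + P j * P i =
    if i = j then (2 : ℝ) • (1 : Matrix (Fin N) (Fin N) ℝ) else 0

/-- The map `F` sending a Clifford system to the quadratic map
`X ↦ (⟨P₁X,X⟩,…,⟨PₙX,X⟩)`. -/
def cliffordMap {N n : ℕ} (P : Fin n → Matrix (Fin N) (Fin N) ℝ) :
    (Fin N → ℝ) → Fin n → ℝ := fun X α => X ⬝ᵥ (P α).mulVec X

/-- Algebraic equivalence of Clifford systems. -/
def CliffordAlgEquiv {N n : ℕ} (P Q : Fin n → Matrix (Fin N) (Fin N) ℝ) : Prop :=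
  ∃ A : Matrix (Fin N) (Fin N) ℝ, IsOrthoMat A ∧ ∀ i, Q i = A * P i * Aᵀ

/-- Irreducibility: the space is not a direct sum of two nontrivial invariant subspaces. -/
def CliffordIrreducible {N n : ℕ} (P : Fin n → Matrix (Fin N) (Fin N) ℝ) : Prop :=
  ¬∃ U V : Submodule ℝ (Fin N → ℝ), U ≠ ⊥ ∧ V ≠ ⊥ ∧ IsCompl U V ∧
    (∀ i, ∀ x ∈ U, (P i).mulVec x ∈ U) ∧ ∀ i, ∀ x ∈ V, (P i).mulVec x ∈ V

/-- An O-system: orthogonal endomorphisms with `τᵢᵗτⱼ + τⱼᵗτᵢ = 2δᵢⱼ Id`. -/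
def IsOSystem {m n : ℕ} (τ : Fin n → Matrix (Fin m) (Fin m) ℝ) : Prop :=
  (∀ i, (τ i)ᵀ * τ i = 1) ∧
  ∀ i j, (τ i)ᵀ * τ j + (τ j)ᵀ * τ i =
    if i = j then (2 : ℝ) • (1 : Matrix (Fin m) (Fin m) ℝ) else 0

/-- Algebraic equivalence of O-systems. -/
def OAlgEquiv {m n : ℕ} (τ ρ : Fin n → Matrix (Fin m) (Fin m) ℝ) : Prop :=
  ∃ θ : Matrix (Fin m) (Fin m) ℝ, IsOrthoMat θ ∧ ∀ i, ρ i = θ * τ i * θᵀ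

/-- Block-diagonal direct sum of square matrices. -/
def bdiag {m l : ℕ} (A : Matrix (Fin m) (Fin m) ℝ) (B : Matrix (Fin l) (Fin l) ℝ) :
    Matrix (Fin (m + l)) (Fin (m + l)) ℝ :=
  (Matrix.fromBlocks A 0 0 B).submatrix finSumFinEquiv.symm finSumFinEquiv.symm

/-- The block matrix `[[I,0],[0,-I]]`. -/
def assocP0 (m : ℕ) : Matrix (Fin (m + m)) (Fin (m + m)) ℝ :=
  (Matrix.fromBlocks 1 0 0 (-1)).submatrix finSumFinEquiv.symm finSumFinEquiv.symm

/-- The block matrix `[[0,τ],[τᵗ,0]]`. -/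
def assocPi {m : ℕ} (τ : Matrix (Fin m) (Fin m) ℝ) : Matrix (Fin (m + m)) (Fin (m + m)) ℝ :=
  (Matrix.fromBlocks 0 τ τᵀ 0).submatrix finSumFinEquiv.symm finSumFinEquiv.symm

/-- The Clifford system `(P₀,P₁,…,Pₙ)` associated to an O-system `(τ₁,…,τₙ)`. -/
def assocClifford {m n : ℕ} (τ : Fin n → Matrix (Fin m) (Fin m) ℝ) :
    Fin (n + 1) → Matrix (Fin (m + m)) (Fin (m + m)) ℝ :=
  Fin.cons (assocP0 m) fun j => assocPi (τ j)

/-- Direct sum of two maps: `(φ ⊕ ψ)(x,y) = φ(x) + ψ(y)`. -/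
def dsum {m l n : ℕ} (φ : (Fin m → ℝ) → Fin n → ℝ) (ψ : (Fin l → ℝ) → Fin n → ℝ) :
    (Fin (m + l) → ℝ) → Fin n → ℝ :=
  fun x => φ (fun i => x (Fin.castAdd l i)) + ψ fun j => x (Fin.natAdd m j)

/-- Transport a map along an equality of domain dimensions. -/
def reMap {a b n : ℕ} (h : a = b) (ψ : (Fin b → ℝ) → Fin n → ℝ) :
    (Fin a → ℝ) → Fin n → ℝ := fun x => ψ fun i => x (finCongr h.symm i)

/-- A separable quadratic harmonic morphism. -/
def Separable {M n : ℕ} (φ : (Fin M → ℝ) → Fin n → ℝ) : Prop :=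
  ∃ (m l : ℕ) (h : M = m + l), 0 < m ∧ 0 < l ∧
    ∃ (φ₁ : (Fin m → ℝ) → Fin n → ℝ) (φ₂ : (Fin l → ℝ) → Fin n → ℝ),
      IsQuadraticHM φ₁ ∧ IsQuadraticHM φ₂ ∧ φ = reMap h (dsum φ₁ φ₂)

/-- The `k`-fold direct sum `ψ₁ ⊕ … ⊕ ψₖ` of maps with the same domain dimension. -/
def bigDSum {k M n : ℕ} (ψ : Fin k → (Fin M → ℝ) → Fin n → ℝ) :
    (Fin (k * M) → ℝ) → Fin n → ℝ :=
  fun x => ∑ j : Fin k, ψ j fun i => x (finProdFinEquiv (j, i))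

/-- Domain-minimality: no quadratic harmonic morphism into `ℝ^n` exists from a
smaller-dimensional domain. -/
def DomainMinimal {M n : ℕ} (φ : (Fin M → ℝ) → Fin n → ℝ) : Prop :=
  IsQuadraticHM φ ∧ ∀ M' : ℕ, M' < M → ¬∃ ψ : (Fin M' → ℝ) → Fin n → ℝ, IsQuadraticHM ψ

/-- `m(n)`: dimensions of irreducible Clifford systems;
`m(1)=1, m(2)=2, m(3)=m(4)=4, m(5)=…=m(8)=8, m(n+8)=16m(n)`. -/
def mfun : ℕ → ℕ
  | 0 => 1
  | 1 => 1
  | 2 => 2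
  | 3 => 4
  | 4 => 4
  | 5 => 8
  | 6 => 8
  | 7 => 8
  | 8 => 8
  | n + 9 => 16 * mfun (n + 1)

/-- The Hurwitz–Radon number: for `m = (2r+1)·2^(c+4d)` with `0 ≤ c ≤ 3`,
`σ(m) = 2^c + 8d`. -/
def hrSigma (m : ℕ) : ℕ := 2 ^ (padicValNat 2 m % 4) + 8 * (padicValNat 2 m / 4)

/-- The quadratic function `F₀(x) = x₁²+…+x_m² − x_{m+1}²−…−x_{2m}²`. -/
def F0 (m : ℕ) : (Fin (m + m) → ℝ) → ℝ :=
  fun x => ∑ i : Fin m, x (Fin.castAdd m i) ^ 2 - ∑ i : Fin m, x (Fin.natAdd m i) ^ 2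

/-- The quadratic function `F(X₁,…,Xₖ) = Σⱼ λⱼ F₀(Xⱼ)`. -/
def bigF {k m : ℕ} (lam : Fin k → ℝ) : (Fin (k * (m + m)) → ℝ) → ℝ :=
  fun x => ∑ j : Fin k, lam j * F0 m fun i => x (finProdFinEquiv (j, i))

theorem finrank_eq_two_mul_finrank_inf_ker {V : Type*} [AddCommGroup V] [Module ℝ V]
    [FiniteDimensional ℝ V] (W : Submodule ℝ V) (T S : V →ₗ[ℝ] V)
    (hT : ∀ x ∈ W, T x ∈ W) (hS : ∀ x ∈ W, S x ∈ W)
    (hTT : ∀ x ∈ W, T (T x) = x) (hST : ∀ x ∈ W, S (T x) = -T (S x))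
    (hinj : ∀ x ∈ W, S x = 0 → x = 0) :
    Module.finrank ℝ W = 2 * Module.finrank ℝ ↥(W ⊓ LinearMap.ker (T - 1)) := by
  set A := W ⊓ LinearMap.ker (T - 1) with hA
  set B := W ⊓ LinearMap.ker (T + 1) with hB
  have memA : ∀ x, x ∈ A ↔ x ∈ W ∧ T x = x := fun x => by
    simp [hA, sub_eq_zero]
  have memB : ∀ x, x ∈ B ↔ x ∈ W ∧ T x = -x := fun x => by
    simp [hB, add_eq_zero_iff_eq_neg]
  have hsup : A ⊔ B = W := by
    apply le_antisymm (sup_le inf_le_left inf_le_left)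
    intro x hx
    rw [Submodule.mem_sup]
    refine ⟨(1 / 2 : ℝ) • (x + T x), ?_, (1 / 2 : ℝ) • (x - T x), ?_, by module⟩
    · rw [memA]
      refine ⟨W.smul_mem _ (W.add_mem hx (hT x hx)), ?_⟩
      simp only [map_smul, map_add, hTT x hx]
      module
    · rw [memB]
      refine ⟨W.smul_mem _ (W.sub_mem hx (hT x hx)), ?_⟩
      simp only [map_smul, map_sub, hTT x hx]
      module
  have hinf : A ⊓ B = ⊥ := by
    rw [eq_bot_iff]
    rintro x ⟨h1, h2⟩
    have h : x = -x := ((memA x).1 h1).2.symm.trans ((memB x).1 h2).2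
    have h' : (2 : ℝ) • x = 0 := by
      rw [two_smul]
      nth_rewrite 2 [h]
      exact add_neg_cancel x
    simpa using h'
  have hSA : ∀ x ∈ A, S x ∈ B := fun x hx => by
    obtain ⟨hW, h⟩ := (memA x).1 hx
    refine (memB _).2 ⟨hS x hW, ?_⟩
    have := hST x hW
    rw [h] at this
    exact (neg_eq_iff_eq_neg.2 this).symm
  have hSB : ∀ x ∈ B, S x ∈ A := fun x hx => by
    obtain ⟨hW, h⟩ := (memB x).1 hx
    refine (memA _).2 ⟨hS x hW, ?_⟩
    have := hST x hW
    rw [h, map_neg] at this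
    exact (neg_injective this).symm
  have hAB : Module.finrank ℝ A ≤ Module.finrank ℝ B := by
    apply LinearMap.finrank_le_finrank_of_injective (f := S.restrict hSA)
    rw [injective_iff_map_eq_zero]
    intro x hx
    exact Subtype.ext (hinj x ((memA _).1 x.2).1 (congrArg Subtype.val hx))
  have hBA : Module.finrank ℝ B ≤ Module.finrank ℝ A := by
    apply LinearMap.finrank_le_finrank_of_injective (f := S.restrict hSB)
    rw [injective_iff_map_eq_zero]
    intro x hx
    exact Subtype.ext (hinj x ((memB _).1 x.2).1 (congrArg Subtype.val hx))
  have h := Submodule.finrank_sup_add_finrank_inf_eq A B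
  rw [hsup, hinf, finrank_bot] at h
  omega

/-- A finite family of anticommuting complex structures on a real vector space. -/
structure IsAntiFamily {r : ℕ} {V : Type*} [AddCommGroup V] [Module ℝ V]
    (J : Fin r → Module.End ℝ V) : Prop where
  sq : ∀ i, J i * J i = -1
  anti : ∀ i j, i ≠ j → J i * J j = -(J j * J i)

/-- The sign picked up when exchanging the members `i` and `j` of an anticommuting family. -/
def swapSign {r : ℕ} (i j : Fin r) : ℤ := if i = j then 1 else -1

theorem swapSign_mul_self {r : ℕ} (i j : Fin r) : swapSign i j * swapSign i j = 1 := by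
  unfold swapSign; split_ifs <;> rfl

/-- The sign picked up when moving the member `i` past the product of `a`, `b`, `c`, `d`. -/
def quadSign {r : ℕ} (a b c d i : Fin r) : ℤ :=
  swapSign i a * swapSign i b * swapSign i c * swapSign i d

theorem quadSign_mul_self {r : ℕ} (a b c d i : Fin r) :
    quadSign a b c d i * quadSign a b c d i = 1 := by
  unfold quadSign
  linear_combination
    (swapSign i b * swapSign i c * swapSign i d) ^ 2 * swapSign_mul_self i a +
    (swapSign i c * swapSign i d) ^ 2 * swapSign_mul_self i b +
    (swapSign i d) ^ 2 * swapSign_mul_self i c + swapSign_mul_self i d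

section Quad

variable {r : ℕ} {R : Type*} [Ring R]

/-- The product of four members of a family. -/
def quad (J : Fin r → R) (a b c d : Fin r) : R := J a * J b * J c * J d

theorem mul_quad (J : Fin r → R) (X : R) (ε : Fin r → ℤ) (h : ∀ i, X * J i = ε i • (J i * X))
    (a b c d : Fin r) :
    X * quad J a b c d = (ε a * ε b * ε c * ε d) • (quad J a b c d * X) := by
  have key : ∀ Y Z : R, ∀ s t : ℤ, X * Y = s • (Y * X) → X * Z = t • (Z * X) →
      X * (Y * Z) = (s * t) • (Y * Z * X) := fun Y Z s t hY hZ => by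
    rw [← mul_assoc, hY, smul_mul_assoc, mul_assoc, hZ, mul_smul_comm, smul_smul, mul_assoc]
  exact key _ _ _ _ (key _ _ _ _ (key _ _ _ _ (h a) (h b)) (h c)) (h d)

theorem pair_mul_self {a b : R} (ha : a * a = -1) (hb : b * b = -1) (hab : a * b = -(b * a)) :
    a * b * (a * b) = -1 := by
  have : a * b * (a * b) = -(b * (a * a) * b) := by
    nth_rw 1 [hab]
    simp only [neg_mul, mul_assoc]
  rw [this, ha]
  simp [hb]

theorem quad_mul_self {a b c d : R} (ha : a * a = -1) (hb : b * b = -1) (hc : c * c = -1)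
    (hd : d * d = -1) (hab : a * b = -(b * a)) (hcd : c * d = -(d * c))
    (h : Commute (a * b) (c * d)) : (a * b * c * d) * (a * b * c * d) = 1 := by
  have h1 : a * b * c * d = (a * b) * (c * d) := mul_assoc _ _ _
  rw [h1, Commute.mul_mul_mul_comm h.symm, pair_mul_self ha hb hab, pair_mul_self hc hd hcd]
  simp

end Quad

namespace IsAntiFamily

variable {r s : ℕ} {V : Type*} [AddCommGroup V] [Module ℝ V] {J : Fin r → Module.End ℝ V}

theorem comp (h : IsAntiFamily J) {f : Fin s → Fin r} (hf : Function.Injective f) :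
    IsAntiFamily (J ∘ f) :=
  ⟨fun i => h.sq (f i), fun _ _ hij => h.anti _ _ (hf.ne hij)⟩

theorem restrict (h : IsAntiFamily J) (W : Submodule ℝ V) (hW : ∀ i, ∀ x ∈ W, J i x ∈ W) :
    IsAntiFamily (fun i => (J i).restrict (hW i)) where
  sq _ := LinearMap.ext fun x => Subtype.ext (LinearMap.congr_fun (h.sq _) x)
  anti _ _ hij := LinearMap.ext fun x => Subtype.ext (LinearMap.congr_fun (h.anti _ _ hij) x)

theorem mul_eq (h : IsAntiFamily J) (i j : Fin r) : J i * J j = swapSign i j • (J j * J i) := by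
  unfold swapSign
  split_ifs with hij
  · rw [hij, one_smul]
  · rw [neg_one_smul, h.anti i j hij]

theorem mul_quad_eq (h : IsAntiFamily J) (a b c d i : Fin r) :
    J i * quad J a b c d = quadSign a b c d i • (quad J a b c d * J i) :=
  mul_quad J (J i) _ (h.mul_eq i) a b c d

theorem quad_mul_eq (h : IsAntiFamily J) (a b c d i : Fin r) :
    quad J a b c d * J i = quadSign a b c d i • (J i * quad J a b c d) := by
  rw [h.mul_quad_eq, smul_smul, quadSign_mul_self, one_smul]

theorem quad_sq (h : IsAntiFamily J) {a b c d : Fin r} (hab : a ≠ b) (hac : a ≠ c) (had : a ≠ d)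
    (hbc : b ≠ c) (hbd : b ≠ d) (hcd : c ≠ d) : quad J a b c d * quad J a b c d = 1 := by
  refine quad_mul_self (h.sq a) (h.sq b) (h.sq c) (h.sq d) (h.anti _ _ hab) (h.anti _ _ hcd) ?_
  have h1 : SemiconjBy (J a) (J c * J d) (-J c * -J d) :=
    SemiconjBy.mul_right (by simp [SemiconjBy, h.anti a c hac])
      (by simp [SemiconjBy, h.anti a d had])
  have h2 : SemiconjBy (J b) (J c * J d) (-J c * -J d) :=
    SemiconjBy.mul_right (by simp [SemiconjBy, h.anti b c hbc])
      (by simp [SemiconjBy, h.anti b d hbd])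
  rw [neg_mul_neg] at h1 h2
  exact Commute.mul_left h1 h2

theorem quad_comm (h : IsAntiFamily J) {a b c d a' b' c' d' : Fin r}
    (hs : quadSign a b c d a' * quadSign a b c d b' * quadSign a b c d c' *
      quadSign a b c d d' = 1) : Commute (quad J a b c d) (quad J a' b' c' d') := by
  have := mul_quad J (quad J a b c d) _ (h.quad_mul_eq a b c d) a' b' c' d'
  rwa [hs, one_smul] at this

theorem comm_quad (h : IsAntiFamily J) {a b c d i : Fin r} (hs : quadSign a b c d i = 1) :
    Commute (J i) (quad J a b c d) := by
  have := h.mul_quad_eq a b c d i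
  rwa [hs, one_smul] at this

theorem anti_quad (h : IsAntiFamily J) {a b c d i : Fin r} (hs : quadSign a b c d i = -1) :
    J i * quad J a b c d = -(quad J a b c d * J i) := by
  have := h.mul_quad_eq a b c d i
  rwa [hs, neg_one_smul] at this

end IsAntiFamily

/-- A quadruple product commutes with anything anticommuting with all members of the family. -/
theorem comm_quad_of_anti {r : ℕ} {R : Type*} [Ring R] {J : Fin r → R} {X : R}
    (h : ∀ i, X * J i = -(J i * X)) (a b c d : Fin r) : Commute X (quad J a b c d) := by
  have := mul_quad J X (fun _ => -1) (fun i => by simpa using h i) a b c d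
  simpa [Commute, SemiconjBy] using this

section Halving

variable {V : Type*} [AddCommGroup V] [Module ℝ V]

theorem mem_inf_ker_sub_one_of_commute {W : Submodule ℝ V} {T X : Module.End ℝ V}
    (h : Commute X T) (hX : ∀ x ∈ W, X x ∈ W) :
    ∀ x ∈ W ⊓ LinearMap.ker (T - 1), X x ∈ W ⊓ LinearMap.ker (T - 1) := by
  rintro x ⟨h1, h2⟩
  refine ⟨hX x h1, ?_⟩
  have h3 : T x = x := by simpa [sub_eq_zero] using h2
  have h4 := LinearMap.congr_fun h.eq x
  simp only [Module.End.mul_apply, h3] at h4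
  simp [← h4]

theorem finrank_halving [FiniteDimensional ℝ V] (W : Submodule ℝ V) {T S : Module.End ℝ V}
    (hT : ∀ x ∈ W, T x ∈ W) (hS : ∀ x ∈ W, S x ∈ W) (hTT : T * T = 1) (hSS : S * S = -1)
    (hST : S * T = -(T * S)) :
    Module.finrank ℝ W = 2 * Module.finrank ℝ ↥(W ⊓ LinearMap.ker (T - 1)) := by
  refine finrank_eq_two_mul_finrank_inf_ker W T S hT hS
    (fun x _ => LinearMap.congr_fun hTT x) (fun x _ => LinearMap.congr_fun hST x) fun x _ hx => ?_
  have := LinearMap.congr_fun hSS x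
  simpa [hx] using this

end Halving

theorem two_dvd_finrank_of_sq {V : Type*} [AddCommGroup V] [Module ℝ V] [FiniteDimensional ℝ V]
    (J : Module.End ℝ V) (h : J * J = -1) : 2 ∣ Module.finrank ℝ V := by
  have h1 := congrArg LinearMap.det h
  rw [map_mul, ← neg_one_smul ℝ (1 : Module.End ℝ V), LinearMap.det_smul, map_one, mul_one] at h1
  rw [← even_iff_two_dvd]
  by_contra hodd
  rw [Nat.not_even_iff_odd] at hodd
  rw [hodd.neg_one_pow] at h1
  nlinarith [mul_self_nonneg (LinearMap.det J)]

theorem four_dvd_finrank_of_anti {V : Type*} [AddCommGroup V] [Module ℝ V]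
    (I J : Module.End ℝ V) (hI : I * I = -1) (hJ : J * J = -1)
    (h : J * I = -(I * J)) : 4 ∣ Module.finrank ℝ V := by
  let q : QuaternionAlgebra.Basis (Module.End ℝ V) (-1 : ℝ) 0 (-1) :=
    { i := I, j := J, k := I * J, i_mul_i := by simp [hI], j_mul_j := by simp [hJ],
      i_mul_j := rfl, j_mul_i := by simp [h] }
  let f : Quaternion ℝ →ₐ[ℝ] Module.End ℝ V := QuaternionAlgebra.lift q
  let _ : Module (Quaternion ℝ) V := Module.compHom V f.toRingHom
  have : IsScalarTower ℝ (Quaternion ℝ) V := ⟨fun a x v => by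
    change f (a • x) v = a • f x v
    rw [map_smul]; rfl⟩
  have := Module.finrank_mul_finrank ℝ (Quaternion ℝ) V
  rw [Quaternion.finrank_eq_four] at this
  exact ⟨_, this.symm⟩

theorem eight_dvd_finrank {V : Type*} [AddCommGroup V] [Module ℝ V] [FiniteDimensional ℝ V]
    {J : Fin 4 → Module.End ℝ V} (h : IsAntiFamily J) : 8 ∣ Module.finrank ℝ V := by
  have hhalf := finrank_halving ⊤ (T := quad J 0 1 2 3) (S := J 0) (by simp) (by simp)
    (h.quad_sq (by decide) (by decide) (by decide) (by decide) (by decide) (by decide))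
    (h.sq 0) (h.anti_quad (by decide))
  rw [finrank_top] at hhalf
  have hpair : ∀ i j, i ≠ j → ∀ x ∈ ⊤ ⊓ LinearMap.ker (quad J 0 1 2 3 - 1),
      (J i * J j) x ∈ ⊤ ⊓ LinearMap.ker (quad J 0 1 2 3 - 1) := by
    intro i j hij
    refine mem_inf_ker_sub_one_of_commute ?_ (by simp)
    have hs : ∀ i : Fin 4, quadSign 0 1 2 3 i = -1 := by decide
    have h1 : SemiconjBy (quad J 0 1 2 3) (J i) (-J i) := by
      have := h.quad_mul_eq 0 1 2 3 i
      simpa [hs, SemiconjBy] using this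
    have h2 : SemiconjBy (quad J 0 1 2 3) (J j) (-J j) := by
      have := h.quad_mul_eq 0 1 2 3 j
      simpa [hs, SemiconjBy] using this
    have h3 := h1.mul_right h2
    rw [neg_mul_neg] at h3
    exact h3.symm
  have h01 : (0 : Fin 4) ≠ 1 := by decide
  have h02 : (0 : Fin 4) ≠ 2 := by decide
  have hsq1 := pair_mul_self (h.sq 0) (h.sq 1) (h.anti 0 1 h01)
  have hsq2 := pair_mul_self (h.sq 0) (h.sq 2) (h.anti 0 2 h02)
  have hanti : J 0 * J 2 * (J 0 * J 1) = -(J 0 * J 1 * (J 0 * J 2)) := by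
    have e1 : J 0 * J 2 * (J 0 * J 1) = J 2 * J 1 := by
      rw [h.anti 0 2 h02]
      simp only [neg_mul, mul_assoc]
      rw [← mul_assoc (J 0) (J 0), h.sq 0]
      simp
    have e2 : J 0 * J 1 * (J 0 * J 2) = J 1 * J 2 := by
      rw [h.anti 0 1 h01]
      simp only [neg_mul, mul_assoc]
      rw [← mul_assoc (J 0) (J 0), h.sq 0]
      simp
    rw [e1, e2, h.anti 2 1 (by decide)]
  have h4 := four_dvd_finrank_of_anti ((J 0 * J 1).restrict (hpair 0 1 h01))
    ((J 0 * J 2).restrict (hpair 0 2 h02))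
    (LinearMap.ext fun x => Subtype.ext (LinearMap.congr_fun hsq1 x))
    (LinearMap.ext fun x => Subtype.ext (LinearMap.congr_fun hsq2 x))
    (LinearMap.ext fun x => Subtype.ext (LinearMap.congr_fun hanti x))
  omega

theorem exists_finrank_eq_sixteen_mul {V : Type*} [AddCommGroup V] [Module ℝ V]
    [FiniteDimensional ℝ V] {J : Fin 8 → Module.End ℝ V} (h : IsAntiFamily J) :
    ∃ W : Submodule ℝ V, Module.finrank ℝ V = 16 * Module.finrank ℝ W ∧
      ∀ X : Module.End ℝ V, (∀ i, X * J i = -(J i * X)) → ∀ x ∈ W, X x ∈ W := by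
  have stable {T₁ : Module.End ℝ V} {W : Submodule ℝ V} {X : Module.End ℝ V} (hc : Commute X T₁)
      (hX : ∀ x ∈ W, X x ∈ W) := mem_inf_ker_sub_one_of_commute hc hX
  have htop : ∀ X : Module.End ℝ V, ∀ x ∈ (⊤ : Submodule ℝ V), X x ∈ (⊤ : Submodule ℝ V) :=
    fun _ _ _ => Submodule.mem_top
  have h1 := finrank_halving ⊤ (T := quad J 0 1 2 3) (S := J 0) (htop _) (htop _)
    (h.quad_sq (by decide) (by decide) (by decide) (by decide) (by decide) (by decide))
    (h.sq 0) (h.anti_quad (by decide))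
  have h2 := finrank_halving _ (T := quad J 0 1 4 5) (S := J 4)
    (stable (T₁ := quad J 0 1 2 3) (h.quad_comm (by decide)) (htop _))
    (stable (h.comm_quad (by decide)) (htop _))
    (h.quad_sq (by decide) (by decide) (by decide) (by decide) (by decide) (by decide))
    (h.sq 4) (h.anti_quad (by decide))
  have h3 := finrank_halving _ (T := quad J 0 2 4 6) (S := J 6)
    (stable (T₁ := quad J 0 1 4 5) (h.quad_comm (by decide))
      (stable (T₁ := quad J 0 1 2 3) (h.quad_comm (by decide)) (htop _)))
    (stable (h.comm_quad (by decide)) (stable (h.comm_quad (by decide)) (htop _)))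
    (h.quad_sq (by decide) (by decide) (by decide) (by decide) (by decide) (by decide))
    (h.sq 6) (h.anti_quad (by decide))
  have h4 := finrank_halving _ (T := quad J 4 5 6 7) (S := J 7)
    (stable (T₁ := quad J 0 2 4 6) (h.quad_comm (by decide))
      (stable (T₁ := quad J 0 1 4 5) (h.quad_comm (by decide))
        (stable (T₁ := quad J 0 1 2 3) (h.quad_comm (by decide)) (htop _))))
    (stable (h.comm_quad (by decide))
      (stable (h.comm_quad (by decide)) (stable (h.comm_quad (by decide)) (htop _))))
    (h.quad_sq (by decide) (by decide) (by decide) (by decide) (by decide) (by decide))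
    (h.sq 7) (h.anti_quad (by decide))
  rw [finrank_top] at h1
  refine ⟨⊤ ⊓ LinearMap.ker (quad J 0 1 2 3 - 1) ⊓ LinearMap.ker (quad J 0 1 4 5 - 1) ⊓
    LinearMap.ker (quad J 0 2 4 6 - 1) ⊓ LinearMap.ker (quad J 4 5 6 7 - 1), by omega,
    fun X hX => ?_⟩
  exact stable (comm_quad_of_anti hX _ _ _ _) (stable (comm_quad_of_anti hX _ _ _ _)
    (stable (comm_quad_of_anti hX _ _ _ _) (stable (comm_quad_of_anti hX _ _ _ _) (htop X))))

theorem IsAntiFamily.mfun_dvd_finrank : ∀ {r : ℕ} {V : Type*} [AddCommGroup V] [Module ℝ V]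
    [FiniteDimensional ℝ V] {J : Fin r → Module.End ℝ V}, IsAntiFamily J →
    mfun (r + 1) ∣ Module.finrank ℝ V
  | 0, _, _, _, _, _, _ => one_dvd _
  | 1, _, _, _, _, J, h => two_dvd_finrank_of_sq (J 0) (h.sq 0)
  | 2, _, _, _, _, J, h =>
    four_dvd_finrank_of_anti (J 0) (J 1) (h.sq 0) (h.sq 1) (h.anti 1 0 (by decide))
  | 3, _, _, _, _, J, h =>
    four_dvd_finrank_of_anti (J 0) (J 1) (h.sq 0) (h.sq 1) (h.anti 1 0 (by decide))
  | 4, _, _, _, _, _, h => eight_dvd_finrank h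
  | 5, _, _, _, _, _, h => eight_dvd_finrank (h.comp (Fin.castLE_injective (by decide : 4 ≤ 5)))
  | 6, _, _, _, _, _, h => eight_dvd_finrank (h.comp (Fin.castLE_injective (by decide : 4 ≤ 6)))
  | 7, _, _, _, _, _, h => eight_dvd_finrank (h.comp (Fin.castLE_injective (by decide : 4 ≤ 7)))
  | r + 8, V, _, _, _, J, h => by
    obtain ⟨W, hW, hinv⟩ := exists_finrank_eq_sixteen_mul (h.comp (Fin.natAdd_injective 8 r))
    have hX : ∀ i : Fin r, ∀ x ∈ W, (J ∘ Fin.castAdd 8) i x ∈ W := fun i =>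
      hinv _ fun j => h.anti _ _ fun hij => by
        have := congrArg Fin.val hij
        simp at this
        omega
    have ih := ((h.comp (Fin.castAdd_injective r 8)).restrict W hX).mfun_dvd_finrank
    rw [hW]
    exact mul_dvd_mul_left 16 ih

/-- A Clifford system of `n + 1` anticommuting involutions lives in a dimension divisible by
`2 m(n)`. -/
theorem two_mul_mfun_dvd_finrank {n : ℕ} (hn : 1 ≤ n) {V : Type*} [AddCommGroup V] [Module ℝ V]
    [FiniteDimensional ℝ V] (P : Fin (n + 1) → Module.End ℝ V) (hsq : ∀ i, P i * P i = 1)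
    (hanti : ∀ i j, i ≠ j → P i * P j = -(P j * P i)) :
    2 * mfun n ∣ Module.finrank ℝ V := by
  obtain ⟨n, rfl⟩ := Nat.exists_eq_add_of_le' hn
  have hne : ∀ i : Fin n, i.succ.succ ≠ (0 : Fin (n + 2)) := fun i => Fin.succ_ne_zero _
  have hne1 : ∀ i : Fin n, i.succ.succ ≠ (1 : Fin (n + 2)) := fun i h =>
    Fin.succ_ne_zero i (Fin.succ_injective _ h)
  have h01 : (1 : Fin (n + 2)) ≠ 0 := by simp
  have hhalf := finrank_eq_two_mul_finrank_inf_ker ⊤ (P 0) (P 1) (by simp) (by simp)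
    (fun x _ => LinearMap.congr_fun (hsq 0) x)
    (fun x _ => LinearMap.congr_fun (hanti 1 0 h01) x)
    (fun x _ hx => by simpa [hx] using (LinearMap.congr_fun (hsq 1) x).symm)
  rw [finrank_top] at hhalf
  rw [hhalf]
  apply mul_dvd_mul_left
  let J : Fin n → Module.End ℝ V := fun i => P 1 * P i.succ.succ
  have hmul : ∀ i j, J i * J j = -(P i.succ.succ * P j.succ.succ) := fun i j => by
    simp only [J]
    rw [hanti 1 i.succ.succ (hne1 i).symm, neg_mul, mul_assoc, ← mul_assoc (P 1) (P 1), hsq 1,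
      one_mul]
  have hJ : IsAntiFamily J := by
    refine ⟨fun i => by rw [hmul, hsq], fun i j hij => ?_⟩
    rw [hmul, hmul, hanti i.succ.succ j.succ.succ
      fun h => hij (Fin.succ_injective _ (Fin.succ_injective _ h))]
  refine (hJ.restrict _ fun i => mem_inf_ker_sub_one_of_commute ?_ (by simp)).mfun_dvd_finrank
  have h1 : SemiconjBy (P 0) (P 1) (-P 1) := by
    simp [SemiconjBy, hanti 0 1 h01.symm]
  have h2 : SemiconjBy (P 0) (P i.succ.succ) (-P i.succ.succ) := by
    simp [SemiconjBy, hanti 0 _ (hne i).symm]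
  have h3 := h1.mul_right h2
  rw [neg_mul_neg] at h3
  exact h3.symm

section Spectrum

variable {n : ℕ} {V : Type*} [AddCommGroup V] [Module ℝ V] [FiniteDimensional ℝ V]
  {T : Fin (n + 1) → Module.End ℝ V} {S : Module.End ℝ V}

theorem two_mul_mfun_dvd_finrank_ker (hn : 1 ≤ n) (hsq : ∀ α, T α * T α = S)
    (hanti : ∀ α β, α ≠ β → T α * T β = -(T β * T α)) {μ : ℝ} (hμ : μ ≠ 0) :
    2 * mfun n ∣ Module.finrank ℝ (LinearMap.ker (S - (μ ^ 2) • (1 : Module.End ℝ V))) := by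
  set W := LinearMap.ker (S - (μ ^ 2) • (1 : Module.End ℝ V)) with hWdef
  have memW : ∀ x, x ∈ W ↔ S x = (μ ^ 2) • x := fun x => by simp [hWdef, sub_eq_zero]
  have hTW : ∀ α, ∀ x ∈ W, (μ⁻¹ • T α) x ∈ W := fun α x hx => by
    have hc : S (T α x) = T α (S x) := by
      rw [← hsq α]; rfl
    rw [memW] at hx ⊢
    simp [hc, hx, smul_comm (μ ^ 2) μ⁻¹]
  have hss : ∀ α, ∀ x ∈ W, T α (T α x) = (μ ^ 2) • x := fun α x hx => by
    rw [← (memW x).1 hx, ← hsq α]; rfl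
  refine two_mul_mfun_dvd_finrank hn (fun α => (μ⁻¹ • T α).restrict (hTW α)) (fun α => ?_)
    fun α β hαβ => ?_
  · refine LinearMap.ext fun x => Subtype.ext ?_
    have h := hss α x x.2
    simp only [Module.End.mul_apply, LinearMap.coe_restrict_apply, LinearMap.smul_apply, map_smul,
      Module.End.one_apply]
    rw [h, smul_smul, smul_smul]
    field_simp
    simp
  · refine LinearMap.ext fun x => Subtype.ext ?_
    have h := LinearMap.congr_fun (hanti α β hαβ) x
    simp only [Module.End.mul_apply, LinearMap.neg_apply] at h
    simp [h]

theorem finrank_ker_eq_two_mul_finrank_eigenspace (hn : 1 ≤ n) (hsq : ∀ α, T α * T α = S)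
    (hanti : ∀ α β, α ≠ β → T α * T β = -(T β * T α)) {μ : ℝ} (hμ : μ ≠ 0) (α : Fin (n + 1)) :
    Module.finrank ℝ (LinearMap.ker (S - (μ ^ 2) • (1 : Module.End ℝ V))) =
      2 * Module.finrank ℝ (Module.End.eigenspace (T α) μ) := by
  set W := LinearMap.ker (S - (μ ^ 2) • (1 : Module.End ℝ V)) with hWdef
  have memW : ∀ x, x ∈ W ↔ S x = (μ ^ 2) • x := fun x => by simp [hWdef, sub_eq_zero]
  have hTW : ∀ α, ∀ x ∈ W, T α x ∈ W := fun α x hx => by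
    have hc : S (T α x) = T α (S x) := by
      rw [← hsq α]; rfl
    rw [memW] at hx ⊢
    simp [hc, hx]
  have hss : ∀ α, ∀ x ∈ W, T α (T α x) = (μ ^ 2) • x := fun α x hx => by
    rw [← (memW x).1 hx, ← hsq α]; rfl
  have : Nontrivial (Fin (n + 1)) := Fin.nontrivial_iff_two_le.2 (by omega)
  obtain ⟨β, hβ⟩ := exists_ne α
  have h := finrank_eq_two_mul_finrank_inf_ker W (μ⁻¹ • T α) (T β)
    (fun x hx => W.smul_mem _ (hTW α x hx)) (hTW β)
    (fun x hx => by
      simp only [LinearMap.smul_apply, map_smul]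
      rw [hss α x hx, smul_smul, smul_smul]
      field_simp
      simp)
    (fun x _ => by
      have h := LinearMap.congr_fun (hanti β α hβ) x
      simp only [Module.End.mul_apply, LinearMap.neg_apply] at h
      simp [h])
    (fun x hx h0 => by
      have h := hss β x hx
      rw [h0, map_zero] at h
      exact (smul_eq_zero.1 h.symm).resolve_left (pow_ne_zero 2 hμ))
  have hE : W ⊓ LinearMap.ker (μ⁻¹ • T α - 1) = Module.End.eigenspace (T α) μ := by
    ext x
    rw [Module.End.mem_eigenspace_iff, Submodule.mem_inf, memW, LinearMap.mem_ker]
    simp only [LinearMap.sub_apply, LinearMap.smul_apply, Module.End.one_apply, sub_eq_zero]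
    rw [inv_smul_eq_iff₀ hμ]
    refine ⟨And.right, fun hx => ⟨?_, hx⟩⟩
    rw [← hsq α, Module.End.mul_apply, hx, map_smul, hx, smul_smul, sq]
  rw [h, hE]

end Spectrum

theorem mfun_pos : ∀ n, 0 < mfun n
  | 0 | 1 | 2 | 3 | 4 | 5 | 6 | 7 | 8 => by decide
  | n + 9 => by
    rw [mfun]
    exact Nat.mul_pos (by norm_num) (mfun_pos (n + 1))

theorem card_filter_eq_count {ι : Type*} [Fintype ι] (f : ι → ℝ) (μ : ℝ) :
    (Finset.univ.filter fun i => f i = μ).card = (Finset.univ.val.map f).count μ := by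
  rw [Multiset.count_map]
  simp only [Finset.card, Finset.filter_val, eq_comm]

/-- A multiset of reals, symmetric about `0` and with multiplicities divisible by `m` away from
`0`, is `m` times the union of some nonnegative numbers and their negatives. -/
theorem exists_nonneg_of_count {k m : ℕ} (hm : 0 < m) (E : Multiset ℝ)
    (hcard : E.card = 2 * k * m) (hdvd : ∀ μ, μ ≠ 0 → m ∣ E.count μ)
    (hneg : ∀ μ, μ ≠ 0 → E.count (-μ) = E.count μ) :
    ∃ lam : Fin k → ℝ, (∀ j, 0 ≤ lam j) ∧ ∀ μ, E.count μ =
      m * (Finset.univ.filter fun j => lam j = μ).card +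
        m * (Finset.univ.filter fun j => lam j = -μ).card := by
  classical
  let P := E.filter (0 < ·)
  let M : Multiset ℝ := ∑ μ ∈ P.toFinset, Multiset.replicate (E.count μ / m) μ
  have hM : ∀ ν, M.count ν = if 0 < ν then E.count ν / m else 0 := fun ν => by
    simp only [M, Multiset.count_sum', Multiset.count_replicate]
    rw [Finset.sum_ite_eq']
    by_cases hν : 0 < ν
    · by_cases hmem : ν ∈ E
      · simp [P, hν, hmem]
      · simp [P, hmem]
    · simp [P, hν]
  have hMP : m • M = P := by
    ext ν
    rw [Multiset.count_nsmul, hM, Multiset.count_filter]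
    split_ifs with h
    · exact Nat.mul_div_cancel' (hdvd ν h.ne')
    · simp
  have hPN : E.filter (· < 0) = P.map Neg.neg := by
    ext ν
    have : (P.map Neg.neg).count ν = P.count (-ν) := by
      conv_lhs => rw [← neg_neg ν]
      exact Multiset.count_map_eq_count' _ _ neg_injective _
    rw [this, Multiset.count_filter, Multiset.count_filter]
    simp only [Left.neg_pos_iff]
    split_ifs with h
    · exact (hneg ν h.ne).symm
    · rfl
  have hPcard : P.card = m * M.card := by
    rw [← hMP, Multiset.card_nsmul]
  have htot : E.card = 2 * (m * M.card) + E.count 0 := by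
    have h1 : E.card = (E.filter (0 < ·)).card + (E.filter fun x => ¬ 0 < x).card := by
      rw [← Multiset.card_add, Multiset.filter_add_not]
    have h2 : (E.filter fun x => ¬ 0 < x) = E.filter (· < 0) + Multiset.replicate (E.count 0) 0 := by
      ext ν
      rw [Multiset.count_add, Multiset.count_filter, Multiset.count_filter,
        Multiset.count_replicate]
      rcases lt_trichotomy ν 0 with h | h | h
      · simp [h, h.le, h.ne']
      · simp [h]
      · simp [h, h.le, h.ne]
    rw [h1, h2, Multiset.card_add, hPN, Multiset.card_map, Multiset.card_replicate]
    change P.card + _ = _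
    rw [hPcard]
    ring
  have hMk : M.card ≤ k := by
    have : 2 * (m * M.card) ≤ 2 * k * m := by omega
    nlinarith
  let L := (M + Multiset.replicate (k - M.card) 0).toList
  have hL : L.length = k := by simp [L, hMk]
  let lam : Fin k → ℝ := fun j => L.get (Fin.cast hL.symm j)
  have hlam : Finset.univ.val.map lam = M + Multiset.replicate (k - M.card) 0 := by
    have h1 : Finset.univ.val.map lam = (List.ofFn lam : Multiset ℝ) := by
      simp
    have h2 : List.ofFn lam = L := by
      apply List.ext_get
      · simp [hL]
      · intro i _ _
        simp [lam]
    rw [h1, h2, Multiset.coe_toList]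
  have hcount : ∀ μ, (Finset.univ.filter fun j => lam j = μ).card =
      (if 0 < μ then E.count μ / m else 0) + if μ = 0 then k - M.card else 0 := fun μ => by
    rw [card_filter_eq_count, hlam, Multiset.count_add, hM, Multiset.count_replicate]
    simp only [eq_comm]
  refine ⟨lam, fun j => ?_, fun μ => ?_⟩
  · by_contra hj
    have h := hcount (lam j)
    rw [not_le] at hj
    rw [if_neg hj.not_gt, if_neg hj.ne] at h
    exact (Finset.card_ne_zero.2 ⟨j, by simp⟩) h
  · rw [hcount, hcount]
    rcases lt_trichotomy μ 0 with h | h | h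
    · simp [h.not_gt, h.ne, h, hneg μ h.ne, Nat.mul_div_cancel' (hdvd μ h.ne)]
    · simp only [h, lt_irrefl, neg_zero, if_true, if_false, zero_add]
      zify [hMk]
      zify at htot hcard
      linear_combination hcard - htot
    · simp [h.not_gt, h.ne', h, Nat.mul_div_cancel' (hdvd μ h.ne')]

/-- The diagonal coefficients of `bigF lam`. -/
def diagCoeff {k m : ℕ} (lam : Fin k → ℝ) (p : Fin k × Fin (m + m)) : ℝ :=
  Fin.append (fun _ : Fin m => lam p.1) (fun _ : Fin m => -lam p.1) p.2

theorem card_diagCoeff {k m : ℕ} (lam : Fin k → ℝ) (μ : ℝ) :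
    (Finset.univ.filter fun p : Fin k × Fin (m + m) => diagCoeff lam p = μ).card =
      m * (Finset.univ.filter fun j => lam j = μ).card +
        m * (Finset.univ.filter fun j => lam j = -μ).card := by
  rw [Finset.card_filter, Finset.card_filter, Finset.card_filter, Fintype.sum_prod_type]
  simp only [Fin.sum_univ_add, diagCoeff,
    Fin.append_left, Fin.append_right, Finset.sum_add_distrib, Finset.sum_const,
    Finset.card_univ, Fintype.card_fin, smul_eq_mul, Finset.mul_sum, neg_eq_iff_eq_neg]

theorem bigF_eq_sum {k m : ℕ} (lam : Fin k → ℝ) (x : Fin (k * (m + m)) → ℝ) :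
    bigF lam x = ∑ p : Fin k × Fin (m + m), diagCoeff lam p * x (finProdFinEquiv p) ^ 2 := by
  simp only [bigF, F0, Fintype.sum_prod_type, Fin.sum_univ_add, diagCoeff,
    Fin.append_left, Fin.append_right, Finset.mul_sum, mul_add, mul_neg, neg_mul,
    Finset.sum_neg_distrib, sub_eq_add_neg]

theorem pderiv_quadratic {N : ℕ} {A : Matrix (Fin N) (Fin N) ℝ} (hA : A.IsSymm)
    (x : Fin N → ℝ) (i : Fin N) :
    pderiv i (fun y => y ⬝ᵥ A *ᵥ y) x = 2 * (A *ᵥ x) i := by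
  have hd : DifferentiableAt ℝ (fun y : Fin N → ℝ => y ⬝ᵥ A *ᵥ y) x := by
    unfold dotProduct Matrix.mulVec dotProduct
    fun_prop
  unfold pderiv
  rw [← hd.lineDeriv_eq_fderiv]
  set v : Fin N → ℝ := Pi.single i 1 with hv
  have hvA : ∀ w : Fin N → ℝ, v ⬝ᵥ w = w i := fun w => by simp [hv]
  have hxv : x ⬝ᵥ A *ᵥ v = (A *ᵥ x) i := by
    rw [dotProduct_mulVec, ← mulVec_transpose, hA.eq, dotProduct_comm, hvA]
  have hexp : ∀ t : ℝ, (x + t • v) ⬝ᵥ A *ᵥ (x + t • v) =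
      x ⬝ᵥ A *ᵥ x + t * (2 * (A *ᵥ x) i) + t ^ 2 * (v ⬝ᵥ A *ᵥ v) := fun t => by
    simp only [mulVec_add, mulVec_smul, add_dotProduct, dotProduct_add, smul_dotProduct,
      dotProduct_smul, smul_eq_mul, hxv, hvA]
    ring
  unfold lineDeriv
  simp only [hexp]
  have h : HasDerivAt (fun t : ℝ => x ⬝ᵥ A *ᵥ x + t * (2 * (A *ᵥ x) i) +
      t ^ 2 * (v ⬝ᵥ A *ᵥ v)) (2 * (A *ᵥ x) i) 0 := by
    have h1 := ((hasDerivAt_id (0 : ℝ)).mul_const (2 * (A *ᵥ x) i)).const_add (x ⬝ᵥ A *ᵥ x)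
    have h2 := (hasDerivAt_pow 2 (0 : ℝ)).mul_const (v ⬝ᵥ A *ᵥ v)
    exact (h1.fun_add h2).congr_deriv (by simp)
  exact h.deriv

/-- Horizontal weak conformality of a quadratic map in terms of its component matrices. -/
theorem exists_mulVec_dotProduct_mulVec {N n : ℕ} {φ : (Fin N → ℝ) → Fin n → ℝ}
    {A : Fin n → Matrix (Fin N) (Fin N) ℝ} (hA : Represents A φ) (hφ : IsHarmonicMorphism φ) :
    ∃ c : (Fin N → ℝ) → ℝ, ∀ x α β,
      (A α *ᵥ x) ⬝ᵥ (A β *ᵥ x) = c x * if α = β then 1 else 0 := by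
  obtain ⟨hsymm, -, hrep⟩ := hA
  obtain ⟨-, lam, hlam⟩ := hφ
  refine ⟨fun x => lam x ^ 2 / 4, fun x α β => ?_⟩
  have h := hlam x α β
  simp only [hrep, pderiv_quadratic (hsymm _)] at h
  rw [dotProduct]
  have h4 : ∑ i, 2 * (A α *ᵥ x) i * (2 * (A β *ᵥ x) i) =
      4 * ∑ i, (A α *ᵥ x) i * (A β *ᵥ x) i := by
    rw [Finset.mul_sum]
    exact Finset.sum_congr rfl fun i _ => by ring
  linear_combination h / 4 - h4 / 4

section SymmetricFamily

variable {E : Type*} [NormedAddCommGroup E] [InnerProductSpace ℝ E]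

theorem LinearMap.IsSymmetric.inner_mul_self_right {S T : E →ₗ[ℝ] E} (hS : S.IsSymmetric) (x : E) :
    inner ℝ ((S * T) x) x = inner ℝ (S x) (T x) := by
  rw [Module.End.mul_apply, hS, real_inner_comm]

theorem mul_self_eq_of_inner_eq {S T : E →ₗ[ℝ] E} (hS : S.IsSymmetric) (hT : T.IsSymmetric)
    (h : ∀ x, inner ℝ (S x) (S x) = inner ℝ (T x) (T x)) : S * S = T * T := by
  have hsymm : (S * S - T * T).IsSymmetric := fun x y => by
    simp only [LinearMap.sub_apply, Module.End.mul_apply, inner_sub_left, inner_sub_right, hS _ _,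
      hT _ _]
  rw [← sub_eq_zero, ← hsymm.inner_map_self_eq_zero]
  intro x
  rw [LinearMap.sub_apply, inner_sub_left, hS.inner_mul_self_right, hT.inner_mul_self_right, h,
    sub_self]

theorem mul_eq_neg_mul_of_inner_eq_zero {S T : E →ₗ[ℝ] E} (hS : S.IsSymmetric)
    (hT : T.IsSymmetric) (h : ∀ x, inner ℝ (S x) (T x) = 0) : S * T = -(T * S) := by
  have hsymm : (S * T + T * S).IsSymmetric := fun x y => by
    simp only [LinearMap.add_apply, Module.End.mul_apply, inner_add_left, inner_add_right, hS _ _,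
      hT _ _]
    ring
  rw [← add_eq_zero_iff_eq_neg, ← hsymm.inner_map_self_eq_zero]
  intro x
  rw [LinearMap.add_apply, inner_add_left, hS.inner_mul_self_right, hT.inner_mul_self_right,
    real_inner_comm (S x) (T x), h, add_zero]

theorem LinearMap.IsSymmetric.inner_self_eq_sum [FiniteDimensional ℝ E] {N : ℕ}
    {T : E →ₗ[ℝ] E} (hT : T.IsSymmetric) (hN : Module.finrank ℝ E = N) (x : E) :
    inner ℝ x (T x) = ∑ i, hT.eigenvalues hN i * inner ℝ (hT.eigenvectorBasis hN i) x ^ 2 := by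
  rw [← (hT.eigenvectorBasis hN).sum_inner_mul_inner x (T x)]
  refine Finset.sum_congr rfl fun i _ => ?_
  rw [← hT, hT.apply_eigenvectorBasis]
  simp only [RCLike.ofReal_real_eq_id, id_eq, real_inner_smul_left]
  rw [real_inner_comm (hT.eigenvectorBasis hN i) x]
  ring

end SymmetricFamily

theorem exists_equiv_of_card_fiber {ι κ : Type*} [Fintype ι] [Fintype κ] (f : ι → ℝ) (g : κ → ℝ)
    (h : ∀ μ, (Finset.univ.filter fun i => f i = μ).card =
      (Finset.univ.filter fun j => g j = μ).card) : ∃ e : ι ≃ κ, ∀ i, g (e i) = f i := by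
  classical
  have e : ∀ μ, Nonempty ({i // f i = μ} ≃ {j // g j = μ}) := fun μ => by
    rw [← Fintype.card_eq, Fintype.card_subtype, Fintype.card_subtype, h]
  exact ⟨Equiv.ofFiberEquiv fun μ => (e μ).some, Equiv.ofFiberEquiv_map _⟩

/-- Every quadratic harmonic morphism `ℝ^{2km(n)} → ℝ^{n+1}` arises
from the single quadratic function `F = λ₁F₀ ⊕ … ⊕ λₖF₀`: each component is
`F ∘ G_α` for some orthogonal `G_α`. -/
theorem qhm_arises_from_single_function (n k : ℕ) (hn : 1 ≤ n) (hk : 1 ≤ k)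
    (φ : (Fin (2 * k * mfun n) → ℝ) → Fin (n + 1) → ℝ) (hφ : IsQuadraticHM φ) :
    ∃ lam : Fin k → ℝ, (∀ j, 0 ≤ lam j) ∧ lam ≠ 0 ∧
      ∃ G : Fin (n + 1) → Matrix (Fin (2 * k * mfun n)) (Fin (2 * k * mfun n)) ℝ,
        (∀ α, IsOrthoMat (G α)) ∧
          ∀ (x : Fin (2 * k * mfun n) → ℝ) (α : Fin (n + 1)),
            φ x α =
              bigF lam fun i =>
                (G α).mulVec x
                  (finCongr
                    (show 2 * k * mfun n = k * (mfun n + mfun n) by ring).symm i) := by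
  obtain ⟨⟨A, hA⟩, hharm⟩ := hφ
  obtain ⟨c, hc⟩ := exists_mulVec_dotProduct_mulVec hA hharm
  obtain ⟨hsymm, hne, hrep⟩ := hA
  let T : Fin (n + 1) → EuclideanSpace ℝ (Fin (2 * k * mfun n)) →ₗ[ℝ]
    EuclideanSpace ℝ (Fin (2 * k * mfun n)) := fun α => Matrix.toEuclideanLin (A α)
  have hT : ∀ α, (T α).IsSymmetric := fun α =>
    Matrix.isSymmetric_toEuclideanLin_iff.2 (by
      rw [Matrix.IsHermitian, Matrix.conjTranspose_eq_transpose_of_trivial]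
      exact hsymm α)
  have hinner : ∀ x α β, inner ℝ (T α x) (T β x) = c x.ofLp * if α = β then 1 else 0 :=
    fun x α β => by
      rw [← hc, dotProduct_comm]
      rfl
  have hsq : ∀ α, T α * T α = T 0 * T 0 := fun α =>
    mul_self_eq_of_inner_eq (hT α) (hT 0) fun x => by rw [hinner, hinner, if_pos rfl, if_pos rfl]
  have hanti : ∀ α β, α ≠ β → T α * T β = -(T β * T α) := fun α β hαβ =>
    mul_eq_neg_mul_of_inner_eq_zero (hT α) (hT β) fun x => by simp [hinner, hαβ]
  have hN : Module.finrank ℝ (EuclideanSpace ℝ (Fin (2 * k * mfun n))) = 2 * k * mfun n := by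
    simp
  have hcount : ∀ α μ, (Finset.univ.filter fun i => (hT α).eigenvalues hN i = μ).card =
      Module.finrank ℝ (Module.End.eigenspace (T α) μ) := fun α μ =>
    (hT α).card_filter_eigenvalues_eq hN μ
  have hpos : ∀ α {μ : ℝ}, μ ≠ 0 → Module.finrank ℝ (Module.End.eigenspace (T α) μ) =
      Module.finrank ℝ (Module.End.eigenspace (T 0) μ) := fun α μ hμ => by
    have h1 := finrank_ker_eq_two_mul_finrank_eigenspace hn hsq hanti hμ α
    have h2 := finrank_ker_eq_two_mul_finrank_eigenspace hn hsq hanti hμ 0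
    omega
  have hzero : ∀ α, Module.End.eigenspace (T α) 0 = Module.End.eigenspace (T 0) 0 := fun α => by
    ext x
    rw [Module.End.mem_eigenspace_iff, Module.End.mem_eigenspace_iff, zero_smul,
      ← inner_self_eq_zero (𝕜 := ℝ), hinner, if_pos rfl,
      ← inner_self_eq_zero (𝕜 := ℝ) (x := T 0 x), hinner, if_pos rfl]
  obtain ⟨lam, hlam, hlamcount⟩ := exists_nonneg_of_count (k := k) (mfun_pos n)
    (Finset.univ.val.map ((hT 0).eigenvalues hN)) (by simp)
    (fun μ hμ => by
      rw [← card_filter_eq_count, hcount]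
      have h1 := finrank_ker_eq_two_mul_finrank_eigenspace hn hsq hanti hμ 0
      have h2 := two_mul_mfun_dvd_finrank_ker hn hsq hanti hμ
      rw [h1] at h2
      exact Nat.dvd_of_mul_dvd_mul_left two_pos h2)
    (fun μ hμ => by
      rw [← card_filter_eq_count, ← card_filter_eq_count, hcount, hcount]
      have h1 := finrank_ker_eq_two_mul_finrank_eigenspace hn hsq hanti hμ 0
      have h2 := finrank_ker_eq_two_mul_finrank_eigenspace hn hsq hanti (neg_ne_zero.2 hμ) 0
      rw [neg_sq] at h2
      omega)
  have hfiber : ∀ α μ,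
      (Finset.univ.filter fun p : Fin k × Fin (mfun n + mfun n) => diagCoeff lam p = μ).card =
        (Finset.univ.filter fun i => (hT α).eigenvalues hN i = μ).card := fun α μ => by
    rw [card_diagCoeff, ← hlamcount, ← card_filter_eq_count, hcount, hcount]
    rcases eq_or_ne μ 0 with rfl | hμ
    · rw [hzero α]
    · rw [hpos α hμ]
  choose e he using fun α =>
    exists_equiv_of_card_fiber (diagCoeff lam) ((hT α).eigenvalues hN) (hfiber α)
  have hdim : 2 * k * mfun n = k * (mfun n + mfun n) := by ring
  let σ : ∀ α : Fin (n + 1), Fin (2 * k * mfun n) ≃ Fin (2 * k * mfun n) := fun α =>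
    (finCongr hdim).trans (finProdFinEquiv.symm.trans (e α))
  let G : Fin (n + 1) → Matrix (Fin (2 * k * mfun n)) (Fin (2 * k * mfun n)) ℝ := fun α i j =>
    ((hT α).eigenvectorBasis hN (σ α i)).ofLp j
  have hG : ∀ α (x : Fin (2 * k * mfun n) → ℝ) i,
      (G α *ᵥ x) i = inner ℝ ((hT α).eigenvectorBasis hN (σ α i)) (WithLp.toLp 2 x) :=
    fun α x i => by
      rw [real_inner_comm]
      exact rfl
  have hφG : ∀ (x : Fin (2 * k * mfun n) → ℝ) (α : Fin (n + 1)),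
      φ x α = bigF lam fun i => (G α *ᵥ x) (finCongr hdim.symm i) := fun x α => by
    have h1 : φ x α = inner ℝ (WithLp.toLp 2 x) (T α (WithLp.toLp 2 x)) := by
      rw [hrep, dotProduct_comm]
      rfl
    rw [h1, (hT α).inner_self_eq_sum hN, bigF_eq_sum, ← Equiv.sum_comp (e α)]
    refine Finset.sum_congr rfl fun p _ => ?_
    rw [he, hG]
    simp [σ]
  refine ⟨lam, hlam, ?_, G, fun α => ?_, hφG⟩
  · rintro rfl
    refine hne 0 (Matrix.toEuclideanLin.injective ?_)
    rw [map_zero, ← (hT 0).inner_map_self_eq_zero]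
    intro x
    have h1 : φ x.ofLp 0 = inner ℝ (T 0 x) x := by
      rw [hrep]
      rfl
    change inner ℝ (T 0 x) x = 0
    rw [← h1, hφG]
    simp [bigF]
  · rw [IsOrthoMat, mul_eq_one_comm]
    ext i j
    have h := orthonormal_iff_ite.1 ((hT α).eigenvectorBasis hN).orthonormal (σ α j) (σ α i)
    rw [Matrix.one_apply]
    simp only [EmbeddingLike.apply_eq_iff_eq, eq_comm (a := j)] at h
    rw [← h]
    rfl
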